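/- arXiv:2212.08422 — 3 statements merged into one kernel-verified Lean document; each statement's English description precedes it below -/
import Mathlib

section
/- Let d ≥ 1 and let A, B be (d+1)-element subsets of the positive integers. Then, in ℝ^{2d}, |A|_{2d} ∩ |B|_{2d} = |A ∩ B|_{2d} if and only if A and B are not intertwining. -/
open Finset

noncomputable section

/-- The moment curve `p_δ(t) = (t, t², …, t^δ)` in `ℝ^δ`. -/
def momCurve (δ : ℕ) (t : ℝ) : Fin δ → ℝ := fun i => t ^ (i.1 + 1)

/-- The points `p_δ(a)` on the moment curve for `a` ranging over a finite set of naturals. -/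
def momPts (δ : ℕ) (A : Finset ℕ) : Set (Fin δ → ℝ) :=
  (fun a : ℕ => momCurve δ (a : ℝ)) '' (A : Set ℕ)

/-- The simplex `|A|_δ`, i.e. the convex hull of the points `p_δ(a)`, `a ∈ A`. -/
def smp (δ : ℕ) (A : Finset ℕ) : Set (Fin δ → ℝ) := convexHull ℝ (momPts δ A)

/-- The cyclic polytope `C(m, δ) = conv{p_δ(1), …, p_δ(m)}`. -/
def cyc (m δ : ℕ) : Set (Fin δ → ℝ) := smp δ (Finset.Icc 1 m)

/-- The last standard basis vector `e_δ` of `ℝ^δ`. -/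
def eLast (δ : ℕ) : Fin δ → ℝ := fun i => if i.1 = δ - 1 then 1 else 0

/-- The last coordinate of a point of `ℝ^δ`. -/
def lastCoord {δ : ℕ} (x : Fin δ → ℝ) : ℝ :=
  if h : 0 < δ then x ⟨δ - 1, Nat.sub_lt h one_pos⟩ else 0

/-- `x` lies strictly above `V`: `x - r • e_δ ∈ V` for some `r > 0`. -/
def StrictlyAbove {δ : ℕ} (x : Fin δ → ℝ) (V : Set (Fin δ → ℝ)) : Prop :=
  ∃ r : ℝ, 0 < r ∧ x - r • eLast δ ∈ V

/-- `x` lies strictly below `V`: `x - r • e_δ ∈ V` for some `r < 0`. -/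
def StrictlyBelow {δ : ℕ} (x : Fin δ → ℝ) (V : Set (Fin δ → ℝ)) : Prop :=
  ∃ r : ℝ, r < 0 ∧ x - r • eLast δ ∈ V

/-- `|F|_δ` is a lower facet of the cyclic polytope `C(m, δ)`. -/
def IsLowerFacet (m δ : ℕ) (F : Finset ℕ) : Prop :=
  F ⊆ Finset.Icc 1 m ∧ F.card = δ ∧
    ∀ i ∈ Finset.Icc 1 m, i ∉ F →
      StrictlyAbove (momCurve δ (i : ℝ))
        ((affineSpan ℝ (momPts δ F) : AffineSubspace ℝ (Fin δ → ℝ)) : Set (Fin δ → ℝ))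

/-- `|F|_δ` is an upper facet of the cyclic polytope `C(m, δ)`. -/
def IsUpperFacet (m δ : ℕ) (F : Finset ℕ) : Prop :=
  F ⊆ Finset.Icc 1 m ∧ F.card = δ ∧
    ∀ i ∈ Finset.Icc 1 m, i ∉ F →
      StrictlyBelow (momCurve δ (i : ℝ))
        ((affineSpan ℝ (momPts δ F) : AffineSubspace ℝ (Fin δ → ℝ)) : Set (Fin δ → ℝ))

/-- The facet `|H ∖ {c}|_δ` of the simplex `|H|_δ` is a lower facet of `|H|_δ`. -/
def IsLowerFacetOfSimplex (δ : ℕ) (H : Finset ℕ) (c : ℕ) : Prop :=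
  c ∈ H ∧ StrictlyAbove (momCurve δ (c : ℝ))
    ((affineSpan ℝ (momPts δ (H.erase c)) : AffineSubspace ℝ (Fin δ → ℝ)) : Set (Fin δ → ℝ))

/-- The facet `|H ∖ {c}|_δ` of the simplex `|H|_δ` is an upper facet of `|H|_δ`. -/
def IsUpperFacetOfSimplex (δ : ℕ) (H : Finset ℕ) (c : ℕ) : Prop :=
  c ∈ H ∧ StrictlyBelow (momCurve δ (c : ℝ))
    ((affineSpan ℝ (momPts δ (H.erase c)) : AffineSubspace ℝ (Fin δ → ℝ)) : Set (Fin δ → ℝ))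

/-- `T` is a triangulation of the cyclic polytope `C(m, δ)`. -/
def IsTriangulation (m δ : ℕ) (T : Finset (Finset ℕ)) : Prop :=
  (∀ S ∈ T, S ⊆ Finset.Icc 1 m ∧ S.card = δ + 1) ∧
  (⋃ S ∈ T, smp δ S) = cyc m δ ∧
  ∀ S ∈ T, ∀ S' ∈ T, smp δ S ∩ smp δ S' = smp δ (S ∩ S')

/-- `A` is a face of the triangulation `T`. -/
def IsFace (T : Finset (Finset ℕ)) (A : Finset ℕ) : Prop := ∃ S ∈ T, A ⊆ S

/-- `A ≀ B`: writing `A = {a_0 < … < a_d}` and `B = {b_0 < … < b_d}`, we have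
`a_0 < b_0 < a_1 < b_1 < … < a_d < b_d`. -/
def Intertwines (d : ℕ) (A B : Finset ℕ) : Prop :=
  ∃ a b : Fin (d + 1) → ℕ, StrictMono a ∧ StrictMono b ∧
    A = Finset.image a Finset.univ ∧ B = Finset.image b Finset.univ ∧
    (∀ i, a i < b i) ∧ ∀ i : Fin d, b i.castSucc < a i.succ

/-- `y = ℓ_S(x)` is the lift of `x ∈ |S|_δ` to `ℝ^{δ+1}` given by the barycentric
coordinates of `x` with respect to the vertices of `|S|_δ`. -/
def IsLift (δ : ℕ) (S : Finset ℕ) (x : Fin δ → ℝ) (y : Fin (δ + 1) → ℝ) : Prop :=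
  ∃ w : ℕ → ℝ, (∀ a ∈ S, 0 ≤ w a) ∧ (∑ a ∈ S, w a) = 1 ∧
    (∑ a ∈ S, w a • momCurve δ (a : ℝ)) = x ∧
    (∑ a ∈ S, w a • momCurve (δ + 1) (a : ℝ)) = y

/-- `|A|_δ` is submerged by the triangulation `T`. -/
def Submerged (δ : ℕ) (T : Finset (Finset ℕ)) (A : Finset ℕ) : Prop :=
  ∀ S ∈ T, ∀ x ∈ smp δ A ∩ smp δ S, ∀ y y' : Fin (δ + 1) → ℝ,
    IsLift δ A x y → IsLift δ S x y' → lastCoord y ≤ lastCoord y'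

/-- `|A|_δ` is supermerged by the triangulation `T`. -/
def Supermerged (δ : ℕ) (T : Finset (Finset ℕ)) (A : Finset ℕ) : Prop :=
  ∀ S ∈ T, ∀ x ∈ smp δ A ∩ smp δ S, ∀ y y' : Fin (δ + 1) → ℝ,
    IsLift δ A x y → IsLift δ S x y' → lastCoord y' ≤ lastCoord y

/-- The second higher Stasheff–Tamari order `T ≤₂ T'`. -/
def HST2 (δ : ℕ) (T T' : Finset (Finset ℕ)) : Prop :=
  ∀ S ∈ T, ∀ S' ∈ T', ∀ x ∈ smp δ S ∩ smp δ S', ∀ y y' : Fin (δ + 1) → ℝ,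
    IsLift δ S x y → IsLift δ S' x y' → lastCoord y ≤ lastCoord y'

open scoped Classical in
/-- The lower triangulation of `C(m, δ)`: the collection of `(δ+1)`-element subsets `F` of
`{1, …, m}` such that `|F|_{δ+1}` is a lower facet of `C(m, δ+1)`. -/
def lowerTriang (m δ : ℕ) : Finset (Finset ℕ) :=
  (Finset.Icc 1 m).powerset.filter (fun F => IsLowerFacet m (δ + 1) F)

open scoped Classical in
/-- The upper triangulation of `C(m, δ)`. -/
def upperTriang (m δ : ℕ) : Finset (Finset ℕ) :=
  (Finset.Icc 1 m).powerset.filter (fun F => IsUpperFacet m (δ + 1) F)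

open scoped Classical in
/-- `L(H)`: the `(δ+1)`-element subsets `G` of `H` with `|G|_{δ+1}` a lower facet of the
simplex `|H|_{δ+1}`. -/
def LH (δ : ℕ) (H : Finset ℕ) : Finset (Finset ℕ) :=
  (H.filter (fun c => IsLowerFacetOfSimplex (δ + 1) H c)).image (fun c => H.erase c)

open scoped Classical in
/-- `U(H)`: the `(δ+1)`-element subsets `G` of `H` with `|G|_{δ+1}` an upper facet of the
simplex `|H|_{δ+1}`. -/
def UH (δ : ℕ) (H : Finset ℕ) : Finset (Finset ℕ) :=
  (H.filter (fun c => IsUpperFacetOfSimplex (δ + 1) H c)).image (fun c => H.erase c)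

/-- A point of the simplex `|S|_δ` is given by nonnegative weights supported on `S`. -/
lemma mem_smp_iff {δ : ℕ} {S : Finset ℕ} {x : Fin δ → ℝ} :
    x ∈ smp δ S ↔ ∃ w : ℕ → ℝ, (∀ a, 0 ≤ w a) ∧ (∀ a ∉ S, w a = 0) ∧ ∑ a ∈ S, w a = 1 ∧
      ∑ a ∈ S, w a • momCurve δ (a : ℝ) = x := by
  constructor
  · intro hx
    refine convexHull_min (t := {x | ∃ w : ℕ → ℝ, (∀ a, 0 ≤ w a) ∧ (∀ a ∉ S, w a = 0) ∧
      ∑ a ∈ S, w a = 1 ∧ ∑ a ∈ S, w a • momCurve δ (a : ℝ) = x}) ?_ ?_ hx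
    · rintro _ ⟨a, ha, rfl⟩
      have ha' : a ∈ S := ha
      refine ⟨fun b => if b = a then 1 else 0, fun b => ?_, fun b hb => ?_, ?_, ?_⟩
      · dsimp only
        split_ifs <;> norm_num
      · exact if_neg (ne_of_mem_of_not_mem ha' hb).symm
      · simp [ha']
      · simp [ha']
    · rintro _ ⟨u, hu, huS, hu1, rfl⟩ _ ⟨v, hv, hvS, hv1, rfl⟩ s t hs ht hst
      refine ⟨fun a => s * u a + t * v a, fun a => ?_, fun a ha => ?_, ?_, ?_⟩
      · have := hu a
        have := hv a
        positivity
      · simp [huS a ha, hvS a ha]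
      · rw [sum_add_distrib, ← mul_sum, ← mul_sum, hu1, hv1, mul_one, mul_one, hst]
      · simp only [add_smul, mul_smul, sum_add_distrib, ← smul_sum]
  · rintro ⟨w, hw, -, hw1, rfl⟩
    exact (convex_convexHull ℝ _).sum_mem (fun a _ => hw a) hw1
      fun a ha => subset_convexHull ℝ _ ⟨a, ha, rfl⟩

lemma smp_mono {δ : ℕ} {S T : Finset ℕ} (h : S ⊆ T) : smp δ S ⊆ smp δ T :=
  convexHull_mono (Set.image_mono (coe_subset.2 h))

/-- Weights whose moments up to order `n` vanish annihilate every polynomial of degree at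
most `n`. -/
lemma sum_mul_eval_eq_zero {n : ℕ} {C : Finset ℕ} {g : ℕ → ℝ}
    (hg : ∀ k ≤ n, ∑ x ∈ C, g x * (x : ℝ) ^ k = 0) {P : Polynomial ℝ} (hP : P.natDegree ≤ n) :
    ∑ x ∈ C, g x * P.eval (x : ℝ) = 0 := by
  simp only [Polynomial.eval_eq_sum_range, mul_sum]
  rw [sum_comm]
  refine sum_eq_zero fun k hk => ?_
  rw [← mul_zero (P.coeff k), ← hg k (by have := mem_range.1 hk; omega), mul_sum]
  exact sum_congr rfl fun x _ => by ring

/-- Specialization of `sum_mul_eval_eq_zero` to a product of linear factors. -/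
lemma sum_mul_prod_sub_eq_zero {n : ℕ} {C D : Finset ℕ} {g : ℕ → ℝ}
    (hg : ∀ k ≤ n, ∑ x ∈ C, g x * (x : ℝ) ^ k = 0) (hD : #D ≤ n) :
    ∑ x ∈ C, g x * ∏ z ∈ D, ((x : ℝ) - z) = 0 := by
  have h := sum_mul_eval_eq_zero hg (P := ∏ z ∈ D, (Polynomial.X - Polynomial.C (z : ℝ)))
    (by rwa [Polynomial.natDegree_finsetProd_X_sub_C_eq_card])
  simpa [Polynomial.eval_prod] using h

lemma prod_sub_ne_zero {D : Finset ℕ} {x : ℕ} (hx : x ∉ D) : ∏ z ∈ D, ((x : ℝ) - z) ≠ 0 := by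
  refine prod_ne_zero_iff.2 fun z hz => sub_ne_zero.2 fun h => hx ?_
  rwa [Nat.cast_injective h]

/-- At most `n + 1` points of the moment curve in `ℝ^n` are affinely independent. -/
lemma eq_zero_of_moments {n : ℕ} {C : Finset ℕ} {g : ℕ → ℝ} (hC : #C ≤ n + 1)
    (hg : ∀ k ≤ n, ∑ x ∈ C, g x * (x : ℝ) ^ k = 0) {x : ℕ} (hx : x ∈ C) : g x = 0 := by
  have h := sum_mul_prod_sub_eq_zero (D := C.erase x) hg
    (by rw [card_erase_of_mem hx]; omega)
  rw [sum_eq_single_of_mem x hx fun y hy hyx => by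
    rw [prod_eq_zero (mem_erase.2 ⟨hyx, hy⟩) (sub_self _), mul_zero]] at h
  exact (mul_eq_zero.1 h).resolve_right (prod_sub_ne_zero (notMem_erase x C))

/-- The relation between two coefficients of an affine dependence of `n + 2` points. -/
lemma pair_relation_of_moments {n : ℕ} {C : Finset ℕ} {g : ℕ → ℝ} (hC : #C ≤ n + 2)
    (hg : ∀ k ≤ n, ∑ x ∈ C, g x * (x : ℝ) ^ k = 0) {x y : ℕ} (hx : x ∈ C) (hy : y ∈ C)
    (hxy : x ≠ y) :
    g x * ∏ z ∈ (C.erase x).erase y, ((x : ℝ) - z) +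
      g y * ∏ z ∈ (C.erase x).erase y, ((y : ℝ) - z) = 0 := by
  have hy' : y ∈ C.erase x := mem_erase.2 ⟨hxy.symm, hy⟩
  have h := sum_mul_prod_sub_eq_zero (D := (C.erase x).erase y) hg
    (by rw [card_erase_of_mem hy', card_erase_of_mem hx]; omega)
  rwa [← add_sum_erase _ _ hx, ← add_sum_erase _ _ hy', sum_eq_zero, add_zero] at h
  intro z hz
  rw [prod_eq_zero hz (sub_self _), mul_zero]

lemma ne_zero_of_moments {n : ℕ} {C : Finset ℕ} {g : ℕ → ℝ} (hC : #C ≤ n + 2)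
    (hg : ∀ k ≤ n, ∑ x ∈ C, g x * (x : ℝ) ^ k = 0) {x y : ℕ} (hx : x ∈ C) (hy : y ∈ C)
    (hgx : g x ≠ 0) : g y ≠ 0 := by
  rcases eq_or_ne x y with rfl | hxy
  · exact hgx
  intro hgy
  have h := pair_relation_of_moments hC hg hx hy hxy
  rw [hgy, zero_mul, add_zero] at h
  exact (mul_ne_zero hgx (prod_sub_ne_zero (by simp))) h

/-- In a nontrivial affine dependence of `n + 2` points on the moment curve, coefficients of
consecutive points have opposite signs. -/
lemma mul_neg_of_moments {n : ℕ} {C : Finset ℕ} {g : ℕ → ℝ} (hC : #C ≤ n + 2)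
    (hg : ∀ k ≤ n, ∑ x ∈ C, g x * (x : ℝ) ^ k = 0) (hne : ∃ x ∈ C, g x ≠ 0) {x y : ℕ}
    (hx : x ∈ C) (hy : y ∈ C) (hxy : x < y) (hcons : ∀ z ∈ C, z ≤ x ∨ y ≤ z) :
    g x * g y < 0 := by
  obtain ⟨x₀, hx₀, hgx₀⟩ := hne
  have hgx := ne_zero_of_moments hC hg hx₀ hx hgx₀
  have hgy := ne_zero_of_moments hC hg hx₀ hy hgx₀
  have h := pair_relation_of_moments hC hg hx hy hxy.ne
  have hpos : 0 < (∏ z ∈ (C.erase x).erase y, ((x : ℝ) - z)) *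
      ∏ z ∈ (C.erase x).erase y, ((y : ℝ) - z) := by
    rw [← prod_mul_distrib]
    refine prod_pos fun z hz => ?_
    obtain ⟨hzy, hzx, hz⟩ := by simpa only [mem_erase] using hz
    rcases hcons z hz with hle | hle
    · have h₁ : (z : ℝ) < x := by exact_mod_cast lt_of_le_of_ne hle hzx
      have h₂ : (x : ℝ) < y := by exact_mod_cast hxy
      exact mul_pos (by linarith) (by linarith)
    · have h₁ : (y : ℝ) < z := by exact_mod_cast lt_of_le_of_ne hle hzy.symm
      have h₂ : (x : ℝ) < y := by exact_mod_cast hxy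
      exact mul_pos_of_neg_of_neg (by linarith) (by linarith)
  generalize (∏ z ∈ (C.erase x).erase y, ((x : ℝ) - z)) = p at h hpos
  generalize (∏ z ∈ (C.erase x).erase y, ((y : ℝ) - z)) = q at h hpos
  have hq : q ≠ 0 := by
    rintro rfl
    simp at hpos
  have hlt : g x * g y * (p * q) < 0 := by
    have : g x * g y * (p * q) = -(g y * q) ^ 2 := by linear_combination g y * q * h
    rw [this]
    have := mul_ne_zero hgy hq
    exact neg_neg_of_pos (by positivity)
  exact neg_of_mul_neg_left hlt hpos.le

/-- More than `n + 1` points on the moment curve in `ℝ^n` are affinely dependent. -/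
lemma exists_moments_eq_zero {n : ℕ} {C : Finset ℕ} (hC : n + 1 < #C) :
    ∃ g : ℕ → ℝ, (∀ k ≤ n, ∑ x ∈ C, g x * (x : ℝ) ^ k = 0) ∧ ∃ x ∈ C, g x ≠ 0 := by
  let M : Matrix (Fin (n + 1)) C ℝ := Matrix.of fun k x => (x.1 : ℝ) ^ k.1
  have hker : LinearMap.ker M.mulVecLin ≠ ⊥ :=
    LinearMap.ker_ne_bot_of_finrank_lt (by simpa using hC)
  obtain ⟨v, hv, hv0⟩ := (Submodule.ne_bot_iff _).1 hker
  obtain ⟨x, hx⟩ := Function.ne_iff.1 hv0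
  refine ⟨fun a => if h : a ∈ C then v ⟨a, h⟩ else 0, fun k hk => ?_, x.1, x.2, ?_⟩
  · have h := congrFun (LinearMap.mem_ker.1 hv) ⟨k, Nat.lt_succ_of_le hk⟩
    rw [← sum_attach]
    simpa [M, Matrix.mulVec, dotProduct, mul_comm] using h
  · simpa using hx

/-- The coordinates of a point of `|S|_δ` are the moments of its weights, summed over any set
containing `S`. -/
lemma sum_mul_pow_eq {δ : ℕ} {S C : Finset ℕ} {w : ℕ → ℝ} {x : Fin δ → ℝ} (hSC : S ⊆ C)
    (hS : ∀ a ∉ S, w a = 0) (hx : ∑ a ∈ S, w a • momCurve δ (a : ℝ) = x) (k : Fin δ) :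
    ∑ a ∈ C, w a * (a : ℝ) ^ (k.1 + 1) = x k := by
  rw [← sum_subset hSC fun a _ ha => by rw [hS a ha, zero_mul], ← hx, Finset.sum_apply]
  exact sum_congr rfl fun a _ => by simp [momCurve]

/-- If `g` alternates in sign along an increasing sequence of `2d + 2` points, starting with a
positive value, and is positive only on `A` and negative only on `B`, then `A ≀ B`. -/
lemma intertwines_of_alternating {d : ℕ} {A B : Finset ℕ} {g : ℕ → ℝ} (hA : #A = d + 1)
    (hB : #B = d + 1) (c : Fin (2 * d + 2) → ℕ) (hc : StrictMono c)
    (hgA : ∀ x, 0 < g x → x ∈ A) (hgB : ∀ x, g x < 0 → x ∈ B)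
    (halt : ∀ (i : ℕ) (h : i + 1 < 2 * d + 2),
      g (c ⟨i, by omega⟩) * g (c ⟨i + 1, h⟩) < 0)
    (h0 : 0 < g (c 0)) : Intertwines d A B := by
  have key : ∀ (i : ℕ) (h : 2 * i + 1 < 2 * d + 2),
      0 < g (c ⟨2 * i, by omega⟩) ∧ g (c ⟨2 * i + 1, h⟩) < 0 := by
    intro i
    induction i with
    | zero => exact fun h => ⟨h0, (pos_iff_neg_of_mul_neg (halt 0 h)).1 h0⟩
    | succ i ih =>
      intro h
      have h₁ := (neg_iff_pos_of_mul_neg (halt (2 * i + 1) (by omega))).1 (ih (by omega)).2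
      exact ⟨h₁, (pos_iff_neg_of_mul_neg (halt (2 * i + 2) (by omega))).1 h₁⟩
  have image_eq : ∀ (S : Finset ℕ) (f : Fin (d + 1) → ℕ), StrictMono f → #S = d + 1 →
      (∀ i, f i ∈ S) → S = univ.image f := by
    intro S f hf hS hmem
    refine (eq_of_subset_of_card_le (image_subset_iff.2 fun i _ => hmem i) ?_).symm
    rw [card_image_of_injective _ hf.injective, hS, card_univ, Fintype.card_fin]
  have hlt : ∀ i j (hi : i < 2 * d + 2) (hj : j < 2 * d + 2), i < j → c ⟨i, hi⟩ < c ⟨j, hj⟩ :=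
    fun i j hi hj hij => hc hij
  have ha : StrictMono fun i : Fin (d + 1) => c ⟨2 * i.1, by omega⟩ :=
    fun i j (hij : i.1 < j.1) => hlt _ _ _ _ (by omega)
  have hb : StrictMono fun i : Fin (d + 1) => c ⟨2 * i.1 + 1, by omega⟩ :=
    fun i j (hij : i.1 < j.1) => hlt _ _ _ _ (by omega)
  refine ⟨_, _, ha, hb, image_eq A _ ha hA fun i => hgA _ (key i.1 (by omega)).1,
    image_eq B _ hb hB fun i => hgB _ (key i.1 (by omega)).2, fun i => hlt _ _ _ _ (by omega),
    fun i => hlt _ _ _ _ ?_⟩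
  simp only [Fin.val_castSucc, Fin.val_succ]
  omega

lemma inter_eq_of_not_intertwines {d : ℕ} {A B : Finset ℕ} (hA : #A = d + 1) (hB : #B = d + 1)
    (h : ¬ (Intertwines d A B ∨ Intertwines d B A)) :
    smp (2 * d) A ∩ smp (2 * d) B = smp (2 * d) (A ∩ B) := by
  refine Set.Subset.antisymm ?_
    (Set.subset_inter (smp_mono inter_subset_left) (smp_mono inter_subset_right))
  rintro x ⟨hxA, hxB⟩
  obtain ⟨u, hu, huA, hu1, hux⟩ := mem_smp_iff.1 hxA
  obtain ⟨v, hv, hvB, hv1, hvx⟩ := mem_smp_iff.1 hxB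
  have hg : ∀ k ≤ 2 * d, ∑ x ∈ A ∪ B, (u x - v x) * (x : ℝ) ^ k = 0 := by
    intro k hk
    simp only [sub_mul, sum_sub_distrib]
    rcases k with _ | k
    · simp only [pow_zero, mul_one]
      rw [← sum_subset subset_union_left fun a _ ha => huA a ha,
        ← sum_subset subset_union_right fun a _ ha => hvB a ha, hu1, hv1, sub_self]
    · rw [sum_mul_pow_eq subset_union_left huA hux ⟨k, hk⟩,
        sum_mul_pow_eq subset_union_right hvB hvx ⟨k, hk⟩, sub_self]
  have hcard : #(A ∪ B) ≤ 2 * d + 2 := (card_union_le A B).trans (by omega)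
  have hgA : ∀ x, 0 < u x - v x → x ∈ A := fun x hx => by
    by_contra hxA
    linarith [huA x hxA, hv x]
  have hgB : ∀ x, u x - v x < 0 → x ∈ B := fun x hx => by
    by_contra hxB
    linarith [hvB x hxB, hu x]
  have huv : ∀ x ∈ A ∪ B, u x - v x = 0 := by
    rcases hcard.lt_or_eq with hlt | heq
    · exact fun x hx => eq_zero_of_moments (by omega) hg hx
    by_contra! hne
    have hmem := fun i => (A ∪ B).orderEmbOfFin_mem heq i
    have hmono : StrictMono ((A ∪ B).orderEmbOfFin heq) := OrderEmbedding.strictMono _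
    have hran := (A ∪ B).range_orderEmbOfFin heq
    generalize ((A ∪ B).orderEmbOfFin heq : Fin (2 * d + 2) → ℕ) = c at hmem hmono hran
    have halt : ∀ (i : ℕ) (h : i + 1 < 2 * d + 2),
        (u (c ⟨i, by omega⟩) - v (c ⟨i, by omega⟩)) * (u (c ⟨i + 1, h⟩) - v (c ⟨i + 1, h⟩)) < 0 := by
      intro i hi
      refine mul_neg_of_moments (g := fun x => u x - v x) hcard hg hne (hmem _) (hmem _)
        (hmono (Nat.lt_succ_self i)) fun z hz => ?_
      obtain ⟨j, rfl⟩ : z ∈ Set.range c := hran ▸ hz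
      rcases Nat.lt_or_ge i j.1 with hij | hij
      · exact Or.inr (hmono.monotone hij)
      · exact Or.inl (hmono.monotone hij)
    rcases (ne_zero_of_moments (g := fun x => u x - v x) hcard hg hne.choose_spec.1 (hmem 0)
      hne.choose_spec.2).lt_or_gt with h0 | h0
    · refine h (Or.inr (intertwines_of_alternating (g := fun x => v x - u x) hB hA c hmono
        (fun x hx => hgB x (by linarith)) (fun x hx => hgA x (by linarith)) (fun i hi => ?_)
        (by linarith)))
      have := halt i hi
      linarith
    · exact h (Or.inl (intertwines_of_alternating (g := fun x => u x - v x) hA hB c hmono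
        hgA hgB halt h0))
  have huAB : ∀ a ∈ A, a ∉ A ∩ B → u a = 0 := fun a ha hab => by
    have h₁ := huv a (mem_union_left B ha)
    have h₂ := hvB a fun hb => hab (mem_inter.2 ⟨ha, hb⟩)
    linarith
  refine mem_smp_iff.2 ⟨u, hu, fun a hab => ?_, ?_, ?_⟩
  · by_cases ha : a ∈ A
    · exact huAB a ha hab
    · exact huA a ha
  · rw [sum_subset inter_subset_left huAB, hu1]
  · rw [sum_subset inter_subset_left fun a ha hab => by rw [huAB a ha hab, zero_smul], hux]

lemma smp_empty (δ : ℕ) : smp δ ∅ = ∅ := by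
  simp [smp, momPts]

/-- Radon's theorem for two sets separated by the signs of an affine dependence. -/
lemma exists_mem_smp_inter_smp {δ : ℕ} {A B : Finset ℕ} {g : ℕ → ℝ} (hAB : Disjoint A B)
    (hA : A.Nonempty) (hgA : ∀ x ∈ A, 0 < g x) (hgB : ∀ x ∈ B, g x < 0)
    (hg : ∀ k ≤ δ, ∑ x ∈ A ∪ B, g x * (x : ℝ) ^ k = 0) :
    (smp δ A ∩ smp δ B).Nonempty := by
  simp only [sum_union hAB] at hg
  have hs : 0 < ∑ x ∈ A, g x := sum_pos hgA hA
  have h0 : ∑ x ∈ A, g x + ∑ x ∈ B, g x = 0 := by simpa using hg 0 (Nat.zero_le δ)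
  have hcm : A.centerMass g (fun a : ℕ => momCurve δ (a : ℝ)) =
      B.centerMass g fun a : ℕ => momCurve δ (a : ℝ) := by
    rw [centerMass, centerMass, eq_neg_of_add_eq_zero_left h0, inv_neg, neg_smul, ← smul_neg]
    congr 1
    ext k
    have := hg (k.1 + 1) k.2
    simp only [Finset.sum_apply, Pi.neg_apply, Pi.smul_apply, momCurve, smul_eq_mul]
    linarith
  refine ⟨_, A.centerMass_mem_convexHull (fun a ha => (hgA a ha).le) hs
    fun a ha => ⟨a, ha, rfl⟩, ?_⟩
  rw [hcm]
  exact B.centerMass_mem_convexHull_of_nonpos (fun a ha => (hgB a ha).le) (by linarith)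
    fun a ha => ⟨a, ha, rfl⟩

lemma smp_inter_smp_ne_of_intertwines {d : ℕ} {A B : Finset ℕ} (h : Intertwines d A B) :
    smp (2 * d) A ∩ smp (2 * d) B ≠ smp (2 * d) (A ∩ B) := by
  obtain ⟨a, b, ha, hb, rfl, rfl, hab, hba⟩ := h
  have hba' : ∀ i j, i < j → b i < a j := by
    intro i j hij
    obtain ⟨i, rfl⟩ := Fin.exists_castSucc_eq.2 (Fin.ne_last_of_lt hij)
    exact (hba i).trans_le (ha.monotone (Fin.castSucc_lt_iff_succ_le.1 hij))
  have hdisj : Disjoint (univ.image a) (univ.image b) := by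
    simp only [disjoint_left, mem_image, mem_univ, true_and]
    rintro _ ⟨i, rfl⟩ ⟨j, hj⟩
    rcases lt_or_ge j i with hji | hij
    · exact (hba' j i hji).ne hj
    · exact ((hab i).trans_le (hb.monotone hij)).ne' hj
  have hcard : #(univ.image a ∪ univ.image b) = 2 * d + 2 := by
    rw [card_union_of_disjoint hdisj, card_image_of_injective _ ha.injective,
      card_image_of_injective _ hb.injective, card_univ, Fintype.card_fin]
    omega
  obtain ⟨g, hg, hne⟩ : ∃ g : ℕ → ℝ, (∀ k ≤ 2 * d,
      ∑ x ∈ univ.image a ∪ univ.image b, g x * (x : ℝ) ^ k = 0) ∧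
      ∃ x ∈ univ.image a ∪ univ.image b, g x ≠ 0 := exists_moments_eq_zero (by omega)
  have hmemA : ∀ i, a i ∈ univ.image a ∪ univ.image b := fun i =>
    mem_union_left _ (mem_image_of_mem a (mem_univ i))
  have hmemB : ∀ i, b i ∈ univ.image a ∪ univ.image b := fun i =>
    mem_union_right _ (mem_image_of_mem b (mem_univ i))
  wlog h0 : 0 < g (a 0) generalizing g
  · have hga := ne_zero_of_moments hcard.le hg hne.choose_spec.1 (hmemA 0) hne.choose_spec.2
    refine this (fun x => -g x) (fun k hk => ?_) ?_ ?_
    · simp only [neg_mul, sum_neg_distrib, hg k hk, neg_zero]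
    · simpa using hne
    · simpa using lt_of_le_of_ne (not_lt.1 h0) hga
  have hneg₁ : ∀ i, g (a i) * g (b i) < 0 := by
    refine fun i => mul_neg_of_moments hcard.le hg hne (hmemA i) (hmemB i) (hab i) ?_
    simp only [mem_union, mem_image, mem_univ, true_and]
    rintro _ (⟨j, rfl⟩ | ⟨j, rfl⟩)
    · rcases lt_or_ge i j with hij | hji
      · exact Or.inr (hba' i j hij).le
      · exact Or.inl (ha.monotone hji)
    · rcases lt_or_ge j i with hji | hij
      · exact Or.inl (hba' j i hji).le
      · exact Or.inr (hb.monotone hij)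
  have hneg₂ : ∀ i : Fin d, g (b i.castSucc) * g (a i.succ) < 0 := by
    refine fun i => mul_neg_of_moments hcard.le hg hne (hmemB _) (hmemA _) (hba i) ?_
    simp only [mem_union, mem_image, mem_univ, true_and]
    rintro _ (⟨j, rfl⟩ | ⟨j, rfl⟩)
    · rcases lt_or_ge i.castSucc j with hij | hji
      · exact Or.inr (ha.monotone (Fin.castSucc_lt_iff_succ_le.1 hij))
      · exact Or.inl ((ha.monotone hji).trans (hab _).le)
    · rcases lt_or_ge i.castSucc j with hij | hji
      · exact Or.inr ((ha.monotone (Fin.castSucc_lt_iff_succ_le.1 hij)).trans (hab j).le)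
      · exact Or.inl (hb.monotone hji)
  have hpos : ∀ i, 0 < g (a i) := by
    intro i
    induction i using Fin.induction with
    | zero => exact h0
    | succ i ih =>
      exact (neg_iff_pos_of_mul_neg (hneg₂ i)).1 ((pos_iff_neg_of_mul_neg (hneg₁ _)).1 ih)
  have hinter := exists_mem_smp_inter_smp hdisj (univ_nonempty.image a)
    (forall_mem_image.2 fun i _ => hpos i)
    (forall_mem_image.2 fun i _ => (pos_iff_neg_of_mul_neg (hneg₁ i)).1 (hpos i)) hg
  rw [disjoint_iff_inter_eq_empty.1 hdisj, smp_empty]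
  exact hinter.ne_empty

/-- `|A|_{2d} ∩ |B|_{2d} = |A ∩ B|_{2d}` iff `A` and `B` are not
intertwining. -/
theorem statement2 (d : ℕ) (hd : 1 ≤ d) (A B : Finset ℕ)
    (hA1 : ∀ a ∈ A, 1 ≤ a) (hB1 : ∀ b ∈ B, 1 ≤ b)
    (hAc : A.card = d + 1) (hBc : B.card = d + 1) :
    smp (2 * d) A ∩ smp (2 * d) B = smp (2 * d) (A ∩ B) ↔
      ¬ (Intertwines d A B ∨ Intertwines d B A) := by
  refine ⟨?_, inter_eq_of_not_intertwines hAc hBc⟩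
  rintro h (hAB | hBA)
  · exact smp_inter_smp_ne_of_intertwines hAB h
  · exact smp_inter_smp_ne_of_intertwines hBA (by rwa [Set.inter_comm, inter_comm])
end
end

section
/- Let d ≥ 1 and m ≥ 2d+1 be integers, and let 𝒯 be a triangulation of the cyclic polytope C(m, 2d). If A and B are both d-faces of 𝒯, then A and B are not intertwining. -/
open Finset

noncomputable section

lemma exists_weights_of_mem_smp {δ : ℕ} {A : Finset ℕ} {x : Fin δ → ℝ} (hx : x ∈ smp δ A) :
    ∃ w : ℕ → ℝ, ∑ a ∈ A, w a = 1 ∧ ∑ a ∈ A, w a • momCurve δ (a : ℝ) = x := by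
  have hsub : smp δ A ⊆ {x | ∃ w : ℕ → ℝ, ∑ a ∈ A, w a = 1 ∧
      ∑ a ∈ A, w a • momCurve δ (a : ℝ) = x} := by
    apply convexHull_min
    · rintro _ ⟨a, ha, rfl⟩
      have ha' : a ∈ A := ha
      exact ⟨Pi.single a 1, by simp [Finset.sum_pi_single', ha'],
        by simp [Pi.single_apply, ite_smul, ha']⟩
    · rintro _ ⟨v, hv, rfl⟩ _ ⟨w, hw, rfl⟩ s t - - hst
      refine ⟨fun a => s * v a + t * w a, ?_, ?_⟩
      · rw [Finset.sum_add_distrib, ← Finset.mul_sum, ← Finset.mul_sum, hv, hw, mul_one, mul_one,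
          hst]
      · simp only [add_smul, mul_smul, Finset.sum_add_distrib, Finset.smul_sum]
  exact hsub hx

lemma sum_smul_momCurve_mem_smp {δ : ℕ} {A : Finset ℕ} {w : ℕ → ℝ} (h0 : ∀ a ∈ A, 0 ≤ w a)
    (h1 : ∑ a ∈ A, w a = 1) : ∑ a ∈ A, w a • momCurve δ (a : ℝ) ∈ smp δ A :=
  (convex_convexHull ℝ _).sum_mem h0 h1 fun a ha => subset_convexHull ℝ _ ⟨a, ha, rfl⟩

/-- Any `δ + 1` or fewer points of the moment curve in `ℝ^δ` are affinely independent. -/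
lemma eq_zero_of_sum_smul_momCurve_eq_zero {δ : ℕ} {S : Finset ℕ} (hS : S.card ≤ δ + 1)
    {v : ℕ → ℝ} (h0 : ∑ a ∈ S, v a = 0) (h1 : ∑ a ∈ S, v a • momCurve δ (a : ℝ) = 0)
    {c : ℕ} (hc : c ∈ S) : v c = 0 := by
  have hpow : ∀ k < δ + 1, ∑ a ∈ S, v a * (a : ℝ) ^ k = 0 := by
    rintro (_ | k) hk
    · simpa using h0
    · simpa [momCurve] using congrFun h1 ⟨k, by omega⟩
  have hinj : Set.InjOn (fun n : ℕ => (n : ℝ)) S := Nat.cast_injective.injOn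
  set P := Lagrange.basis S (fun n : ℕ => (n : ℝ)) c
  have hdeg : P.natDegree < δ + 1 := by
    have : P.natDegree = S.card - 1 := Lagrange.natDegree_basis hinj hc
    have := Finset.card_pos.2 ⟨c, hc⟩
    omega
  have hsum : ∑ a ∈ S, v a * P.eval (a : ℝ) = 0 := by
    simp_rw [Polynomial.eval_eq_sum_range' hdeg, Finset.mul_sum]
    rw [Finset.sum_comm]
    refine Finset.sum_eq_zero fun k hk => ?_
    rw [← mul_zero (P.coeff k), ← hpow k (Finset.mem_range.1 hk), Finset.mul_sum]
    exact Finset.sum_congr rfl fun a _ => by ring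
  rw [Finset.sum_eq_single_of_mem c hc] at hsum
  · simpa [P, Lagrange.eval_basis_self hinj hc] using hsum
  · intro a ha hac
    simp [P, Lagrange.eval_basis_of_ne (v := fun n : ℕ => (n : ℝ)) (Ne.symm hac) ha]

/-- The affine dependence of `δ + 2` points of the moment curve in `ℝ^δ`. -/
lemma sum_pow_div_prod_sub_eq_zero {U : Finset ℕ} {k : ℕ} (hk : k + 1 < U.card) :
    ∑ c ∈ U, (c : ℝ) ^ k / ∏ j ∈ U.erase c, ((c : ℝ) - j) = 0 := by
  have h := Lagrange.coeff_eq_sum (s := U) (v := fun n : ℕ => (n : ℝ))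
    Nat.cast_injective.injOn (P := (Polynomial.X ^ k : Polynomial ℝ))
    (by rw [Polynomial.degree_X_pow]; exact_mod_cast (by omega))
  rw [Polynomial.coeff_X_pow, if_neg (by omega)] at h
  simpa using h.symm

lemma prod_sub_erase_image_union_image {d : ℕ} {a b : Fin (d + 1) → ℕ}
    (ha : Function.Injective a) (hb : Function.Injective b) (hab : ∀ i j, a i ≠ b j)
    (i : Fin (d + 1)) :
    ∏ j ∈ (univ.image a ∪ univ.image b).erase (a i), ((a i : ℝ) - j) =
      ((a i : ℝ) - b i) * ∏ j ∈ univ.erase i, (((a i : ℝ) - a j) * ((a i : ℝ) - b j)) := by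
  have hU : (univ.image a ∪ univ.image b).erase (a i) = (univ.erase i).image a ∪ univ.image b := by
    ext x
    simp only [mem_erase, mem_union, mem_image, mem_univ, true_and, and_true]
    constructor
    · rintro ⟨hx, ⟨j, rfl⟩ | h⟩
      · exact Or.inl ⟨j, fun h => hx (h ▸ rfl), rfl⟩
      · exact Or.inr h
    · rintro (⟨j, hj, rfl⟩ | ⟨j, rfl⟩)
      · exact ⟨fun h => hj (ha h), Or.inl ⟨j, rfl⟩⟩
      · exact ⟨(hab i j).symm, Or.inr ⟨j, rfl⟩⟩
  have hdisj : Disjoint ((univ.erase i).image a) (univ.image b) := by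
    rw [Finset.disjoint_left]
    intro x hx hx'
    obtain ⟨j, -, rfl⟩ := mem_image.1 hx
    obtain ⟨l, -, hl⟩ := mem_image.1 hx'
    exact hab j l hl.symm
  rw [hU, prod_union hdisj, prod_image ha.injOn, prod_image hb.injOn,
    ← mul_prod_erase univ (fun j => (a i : ℝ) - b j) (mem_univ i), prod_mul_distrib]
  ring

lemma exists_weights_of_intertwines {d : ℕ} {A B : Finset ℕ} (h : Intertwines d A B) :
    Disjoint A B ∧ A.card = d + 1 ∧ B.card = d + 1 ∧ ∃ v w : ℕ → ℝ, (∀ c ∈ A, 0 < v c) ∧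
      (∀ c ∈ B, 0 < w c) ∧ ∑ c ∈ A, v c = 1 ∧ ∑ c ∈ B, w c = 1 ∧
      ∑ c ∈ A, v c • momCurve (2 * d) (c : ℝ) = ∑ c ∈ B, w c • momCurve (2 * d) (c : ℝ) := by
  obtain ⟨a, b, ha, hb, hA, hB, hab, hba⟩ := h
  have hlt : ∀ i j, j < i → b j < a i := by
    intro i j hij
    have hj : j.1 < d := by have := i.2; have : j.1 < i.1 := hij; omega
    refine (hba ⟨j, hj⟩).trans_le (ha.monotone ?_)
    rw [Fin.le_def]
    have : j.1 < i.1 := hij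
    simpa using this
  have hle : ∀ i j, i ≤ j → a i < b j := fun i j hij => (ha.monotone hij).trans_lt (hab j)
  have hne : ∀ i j, a i ≠ b j := fun i j => by
    rcases lt_or_ge j i with h | h
    · exact (hlt i j h).ne'
    · exact (hle i j h).ne
  have hdisj : Disjoint A B := by
    rw [Finset.disjoint_left, hA, hB]
    intro x hx hx'
    obtain ⟨i, -, rfl⟩ := mem_image.1 hx
    obtain ⟨j, -, hj⟩ := mem_image.1 hx'
    exact hne i j hj.symm
  have hAc : A.card = d + 1 := by rw [hA, card_image_of_injective _ ha.injective]; simp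
  have hBc : B.card = d + 1 := by rw [hB, card_image_of_injective _ hb.injective]; simp
  set q : ℕ → ℝ := fun c => ∏ j ∈ (A ∪ B).erase c, ((c : ℝ) - j) with hq
  have hqA : ∀ c ∈ A, q c < 0 := by
    intro c hc
    rw [hA] at hc
    obtain ⟨i, -, rfl⟩ := mem_image.1 hc
    rw [hq, hA, hB]
    simp only
    rw [prod_sub_erase_image_union_image ha.injective hb.injective hne]
    refine mul_neg_of_neg_of_pos (sub_neg.2 (by exact_mod_cast hab i)) (prod_pos fun j hj => ?_)
    rcases lt_or_gt_of_ne (ne_of_mem_erase hj) with h | h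
    · exact mul_pos (sub_pos.2 (by exact_mod_cast ha h)) (sub_pos.2 (by exact_mod_cast hlt i j h))
    · exact mul_pos_of_neg_of_neg (sub_neg.2 (by exact_mod_cast ha h))
        (sub_neg.2 (by exact_mod_cast hle i j h.le))
  have hqB : ∀ c ∈ B, 0 < q c := by
    intro c hc
    rw [hB] at hc
    obtain ⟨i, -, rfl⟩ := mem_image.1 hc
    rw [hq, hA, hB]
    simp only
    rw [union_comm, prod_sub_erase_image_union_image hb.injective ha.injective
      fun i j => (hne j i).symm]
    refine mul_pos (sub_pos.2 (by exact_mod_cast hab i)) (prod_pos fun j hj => ?_)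
    rcases lt_or_gt_of_ne (ne_of_mem_erase hj) with h | h
    · exact mul_pos (sub_pos.2 (by exact_mod_cast hb h))
        (sub_pos.2 (by exact_mod_cast hle j i h.le))
    · exact mul_pos_of_neg_of_neg (sub_neg.2 (by exact_mod_cast hb h))
        (sub_neg.2 (by exact_mod_cast hlt j i h))
  have hpow : ∀ k ≤ 2 * d, ∑ c ∈ A, -(q c)⁻¹ * (c : ℝ) ^ k = ∑ c ∈ B, (q c)⁻¹ * (c : ℝ) ^ k := by
    intro k hk
    have h := sum_pow_div_prod_sub_eq_zero (U := A ∪ B) (k := k)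
      (by rw [card_union_of_disjoint hdisj]; omega)
    rw [sum_union hdisj] at h
    simp only [neg_mul, sum_neg_distrib]
    rw [neg_eq_iff_add_eq_zero, ← h]
    simp only [q, div_eq_inv_mul]
  set W := ∑ c ∈ B, (q c)⁻¹ with hW
  have hWpos : 0 < W := sum_pos (fun c hc => inv_pos.2 (hqB c hc)) (card_pos.1 (by omega))
  have hWA : ∑ c ∈ A, -(q c)⁻¹ = W := by simpa using hpow 0 (by omega)
  refine ⟨hdisj, hAc, hBc, fun c => W⁻¹ * -(q c)⁻¹, fun c => W⁻¹ * (q c)⁻¹,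
    fun c hc => mul_pos (inv_pos.2 hWpos) (neg_pos.2 (inv_lt_zero.2 (hqA c hc))),
    fun c hc => mul_pos (inv_pos.2 hWpos) (inv_pos.2 (hqB c hc)), ?_, ?_, ?_⟩
  · rw [← mul_sum, hWA, inv_mul_cancel₀ hWpos.ne']
  · rw [← mul_sum, ← hW, inv_mul_cancel₀ hWpos.ne']
  · simp only [mul_smul, ← smul_sum]
    congr 1
    funext k
    simpa [momCurve] using hpow (k + 1) (by omega)

/-- If a point of the relative interior of `|A|`, for `A` a subset of an affinely independent `S`,
lies in `|R|` with `R ⊆ S`, then `A ⊆ R`. -/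
lemma subset_of_sum_smul_mem_smp {δ : ℕ} {S A R : Finset ℕ} (hS : S.card ≤ δ + 1) (hA : A ⊆ S)
    (hR : R ⊆ S) {v : ℕ → ℝ} (hv : ∀ c ∈ A, 0 < v c) (hv1 : ∑ c ∈ A, v c = 1)
    (h : ∑ c ∈ A, v c • momCurve δ (c : ℝ) ∈ smp δ R) : A ⊆ R := by
  obtain ⟨w, hw1, hw⟩ := exists_weights_of_mem_smp h
  intro c hc
  by_contra hcR
  have key := eq_zero_of_sum_smul_momCurve_eq_zero hS
    (v := fun c => (if c ∈ A then v c else 0) - if c ∈ R then w c else 0) ?_ ?_ (hA hc)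
  · simp only [hc, hcR, if_true, if_false, sub_zero] at key
    exact (hv c hc).ne' key
  · rw [sum_sub_distrib, sum_ite_mem, sum_ite_mem, inter_eq_right.2 hA, inter_eq_right.2 hR, hv1,
      hw1, sub_self]
  · simp only [sub_smul, ite_smul, zero_smul]
    rw [sum_sub_distrib, sum_ite_mem, sum_ite_mem, inter_eq_right.2 hA, inter_eq_right.2 hR, hw,
      sub_self]

lemma not_intertwines_of_isFace {d m : ℕ} {T : Finset (Finset ℕ)}
    (hT : IsTriangulation m (2 * d) T) {A B : Finset ℕ} (hA : IsFace T A) (hB : IsFace T B) :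
    ¬ Intertwines d A B := by
  intro h
  obtain ⟨hdisj, hAc, hBc, v, w, hv, hw, hv1, hw1, hvw⟩ := exists_weights_of_intertwines h
  obtain ⟨S, hS, hAS⟩ := hA
  obtain ⟨S', hS', hBS'⟩ := hB
  obtain ⟨hcard, -, hinter⟩ := hT
  have hmono : ∀ {X Y : Finset ℕ}, X ⊆ Y → smp (2 * d) X ⊆ smp (2 * d) Y := fun hXY =>
    convexHull_mono (Set.image_mono (coe_subset.2 hXY))
  have hxB : ∑ c ∈ B, w c • momCurve (2 * d) (c : ℝ) ∈ smp (2 * d) (S ∩ S') := by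
    rw [← hinter S hS S' hS']
    refine ⟨?_, hmono hBS' (sum_smul_momCurve_mem_smp (fun c hc => (hw c hc).le) hw1)⟩
    rw [← hvw]
    exact hmono hAS (sum_smul_momCurve_mem_smp (fun c hc => (hv c hc).le) hv1)
  have hB' := subset_of_sum_smul_mem_smp (hcard S' hS').2.le hBS' inter_subset_right hw hw1 hxB
  have hAB : (A ∪ B).card ≤ S.card :=
    card_le_card (union_subset hAS (hB'.trans inter_subset_left))
  rw [card_union_of_disjoint hdisj, (hcard S hS).2] at hAB
  omega

/-- two `d`-faces of a triangulation of `C(m, 2d)` are not intertwining. -/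
theorem statement3 (d m : ℕ) (hd : 1 ≤ d) (hm : 2 * d + 1 ≤ m)
    (T : Finset (Finset ℕ)) (hT : IsTriangulation m (2 * d) T)
    (A B : Finset ℕ) (hAc : A.card = d + 1) (hBc : B.card = d + 1)
    (hA : IsFace T A) (hB : IsFace T B) :
    ¬ (Intertwines d A B ∨ Intertwines d B A) := by
  rintro (h | h)
  · exact not_intertwines_of_isFace hT hA hB h
  · exact not_intertwines_of_isFace hT hB hA h
end
end

section
/- Let d ≥ 1 and m ≥ 2d+1 be integers and let A = {a_0 < a_1 < … < a_d} be a (d+1)-element subset of {1, …, m}. Then the d-simplex |A|_{2d} is contained in no lower facet and no upper facet of the cyclic polytope C(m, 2d) if and only if a_{i+1} ≥ a_i + 2 for all 0 ≤ i ≤ d−1 and a_d + 2 ≤ a_0 + m. -/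
open Finset

noncomputable section

/-- The value at `x` of the affine functional on `ℝ^δ` that restricts to the polynomial `P` along
the moment curve, for `P` of degree at most `δ`. -/
def momFunctional (δ : ℕ) (P : Polynomial ℝ) (x : Fin δ → ℝ) : ℝ :=
  P.coeff 0 + ∑ j : Fin δ, P.coeff (j.1 + 1) * x j

theorem momFunctional_momCurve {δ : ℕ} {P : Polynomial ℝ} (hP : P.natDegree ≤ δ) (t : ℝ) :
    momFunctional δ P (momCurve δ t) = P.eval t := by
  rw [Polynomial.eval_eq_sum_range' (Nat.lt_succ_of_le hP), Finset.sum_range_succ',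
    ← Fin.sum_univ_eq_sum_range (fun j => P.coeff (j + 1) * t ^ (j + 1))]
  simp [momFunctional, momCurve, add_comm]

theorem momFunctional_sub_smul_eLast {δ : ℕ} (hδ : 1 ≤ δ) (P : Polynomial ℝ) (x : Fin δ → ℝ)
    (r : ℝ) :
    momFunctional δ P (x - r • eLast δ) = momFunctional δ P x - r * P.coeff δ := by
  have hlast : ∑ j : Fin δ, P.coeff (j.1 + 1) * (r * eLast δ j) = r * P.coeff δ := by
    rw [Finset.sum_eq_single (⟨δ - 1, by omega⟩ : Fin δ)]
    · simp [eLast, Nat.sub_add_cancel hδ, mul_comm]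
    · intro j _ hj
      have : j.1 ≠ δ - 1 := fun h => hj (Fin.ext h)
      simp [eLast, this]
    · simp
  simp only [momFunctional, Pi.sub_apply, Pi.smul_apply, smul_eq_mul, mul_sub,
    Finset.sum_sub_distrib, hlast]
  ring

theorem momFunctional_eq_zero_of_mem_affineSpan {δ : ℕ} {P : Polynomial ℝ} {s : Set (Fin δ → ℝ)}
    (hs : ∀ x ∈ s, momFunctional δ P x = 0) {x : Fin δ → ℝ} (hx : x ∈ affineSpan ℝ s) :
    momFunctional δ P x = 0 := by
  refine affineSpan_induction (p := fun y => momFunctional δ P y = 0) hx hs ?_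
  intro c u v w hu hv hw
  have key : momFunctional δ P (c • (u -ᵥ v) +ᵥ w)
        = c * (momFunctional δ P u - momFunctional δ P v) + momFunctional δ P w := by
      simp only [momFunctional, vsub_eq_sub, vadd_eq_add, Pi.add_apply, Pi.smul_apply,
        Pi.sub_apply, smul_eq_mul, mul_add, mul_sub, Finset.sum_add_distrib,
        Finset.sum_sub_distrib, Finset.mul_sum, mul_left_comm]
      ring
  rw [key, hu, hv, hw]
  ring

/-- The monic polynomial whose roots are the elements of `F`. -/
abbrev rootPoly (F : Finset ℕ) : Polynomial ℝ := Lagrange.nodal F (fun n : ℕ => (n : ℝ))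

theorem eval_rootPoly_eq_zero_iff (F : Finset ℕ) (n : ℕ) :
    (rootPoly F).eval (n : ℝ) = 0 ↔ n ∈ F := by
  simp [Lagrange.eval_nodal, Finset.prod_eq_zero_iff, sub_eq_zero]

theorem coeff_rootPoly_card (F : Finset ℕ) : (rootPoly F).coeff F.card = 1 := by
  simpa [Polynomial.Monic, Polynomial.leadingCoeff, Lagrange.natDegree_nodal] using
    Lagrange.nodal_monic (s := F) (v := fun n : ℕ => (n : ℝ))

theorem momFunctional_rootPoly_eq_zero {F : Finset ℕ} {x : Fin F.card → ℝ}
    (hx : x ∈ affineSpan ℝ (momPts F.card F)) : momFunctional F.card (rootPoly F) x = 0 := by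
  refine momFunctional_eq_zero_of_mem_affineSpan ?_ hx
  rintro _ ⟨f, hf, rfl⟩
  simpa only [momFunctional_momCurve (Lagrange.natDegree_nodal).le] using
    (eval_rootPoly_eq_zero_iff F f).2 hf

theorem eval_eq_sum_lagrange {F : Finset ℕ} {q : Polynomial ℝ} (hq : q.degree < F.card) (t : ℝ) :
    q.eval t =
      ∑ f ∈ F, q.eval (f : ℝ) * (Lagrange.basis F (fun n : ℕ => (n : ℝ)) f).eval t := by
  conv_lhs => rw [Lagrange.eq_interpolate (v := fun n : ℕ => (n : ℝ))
    (Nat.cast_injective.injOn) hq]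
  simp [Lagrange.interpolate_apply, Polynomial.eval_finsetSum]

theorem momCurve_sub_mem_affineSpan {F : Finset ℕ} (hF : 1 ≤ F.card) (t : ℝ) :
    momCurve F.card t - (rootPoly F).eval t • eLast F.card ∈
      affineSpan ℝ (momPts F.card F) := by
  set w : ℕ → ℝ := fun f => (Lagrange.basis F (fun n : ℕ => (n : ℝ)) f).eval t with hw
  have hsum : ∑ f ∈ F, w f = 1 := by
    have := eval_eq_sum_lagrange (F := F) (q := 1)
      (by rw [Polynomial.degree_one]; exact_mod_cast hF) t
    simpa using this.symm
  have hcomb : momCurve F.card t - (rootPoly F).eval t • eLast F.card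
      = F.affineCombination ℝ (fun f : ℕ => momCurve F.card (f : ℝ)) w := by
    rw [Finset.affineCombination_eq_linear_combination _ _ _ hsum]
    ext j
    simp only [Pi.sub_apply, Pi.smul_apply, smul_eq_mul, Finset.sum_apply, momCurve, eLast]
    split_ifs with hj
    · have hj' : j.1 + 1 = F.card := by omega
      have hdeg : (Polynomial.X ^ F.card - rootPoly F : Polynomial ℝ).degree < F.card := by
        have h := Polynomial.degree_sub_lt_left (p := (Polynomial.X ^ F.card : Polynomial ℝ))
          (q := rootPoly F) (by simp [Lagrange.degree_nodal])
          (pow_ne_zero _ Polynomial.X_ne_zero)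
          (by rw [(Lagrange.nodal_monic).leadingCoeff, (Polynomial.monic_X_pow _).leadingCoeff])
        simpa using h
      have h := eval_eq_sum_lagrange hdeg t
      simp only [Polynomial.eval_sub, Polynomial.eval_pow, Polynomial.eval_X] at h
      rw [hj', mul_one, h]
      refine Finset.sum_congr rfl fun f hf => ?_
      rw [(eval_rootPoly_eq_zero_iff F f).2 hf, sub_zero, mul_comm]
    · have hdeg : (Polynomial.X ^ (j.1 + 1) : Polynomial ℝ).degree < F.card := by
        rw [Polynomial.degree_X_pow]
        have := j.2
        exact_mod_cast (by omega : j.1 + 1 < F.card)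
      have h := eval_eq_sum_lagrange hdeg t
      simp only [Polynomial.eval_pow, Polynomial.eval_X] at h
      rw [mul_zero, sub_zero, h]
      exact Finset.sum_congr rfl fun f _ => mul_comm _ _
  rw [hcomb]
  have himage : momPts F.card F = (fun f : ℕ => momCurve F.card (f : ℝ)) '' (F : Set ℕ) := rfl
  rw [himage]
  exact affineCombination_mem_affineSpan_image hsum (fun i hi hi' => absurd hi hi') _

theorem sub_smul_eLast_mem_affineSpan_iff {F : Finset ℕ} (hF : 1 ≤ F.card) (t r : ℝ) :
    momCurve F.card t - r • eLast F.card ∈ affineSpan ℝ (momPts F.card F) ↔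
      r = (rootPoly F).eval t := by
  constructor
  · intro h
    have h0 := momFunctional_rootPoly_eq_zero h
    rw [momFunctional_sub_smul_eLast hF, momFunctional_momCurve (Lagrange.natDegree_nodal).le,
      coeff_rootPoly_card] at h0
    linarith
  · rintro rfl
    exact momCurve_sub_mem_affineSpan hF t

theorem isLowerFacet_iff {m δ : ℕ} (hδ : 1 ≤ δ) (F : Finset ℕ) :
    IsLowerFacet m δ F ↔ F ⊆ Finset.Icc 1 m ∧ F.card = δ ∧
      ∀ i ∈ Finset.Icc 1 m, i ∉ F → 0 < (rootPoly F).eval (i : ℝ) := by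
  refine and_congr_right fun _ => and_congr_right fun hc => ?_
  subst hc
  simp only [StrictlyAbove, SetLike.mem_coe, sub_smul_eLast_mem_affineSpan_iff hδ,
    exists_eq_right]

theorem isUpperFacet_iff {m δ : ℕ} (hδ : 1 ≤ δ) (F : Finset ℕ) :
    IsUpperFacet m δ F ↔ F ⊆ Finset.Icc 1 m ∧ F.card = δ ∧
      ∀ i ∈ Finset.Icc 1 m, i ∉ F → (rootPoly F).eval (i : ℝ) < 0 := by
  refine and_congr_right fun _ => and_congr_right fun hc => ?_
  subst hc
  simp only [StrictlyBelow, SetLike.mem_coe, sub_smul_eLast_mem_affineSpan_iff hδ,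
    exists_eq_right]

theorem smp_subset_smp_iff {A F : Finset ℕ} : smp F.card A ⊆ smp F.card F ↔ A ⊆ F := by
  constructor
  · intro h a ha
    have hmem : momCurve F.card (a : ℝ) ∈ smp F.card A :=
      subset_convexHull ℝ _ ⟨a, ha, rfl⟩
    have h0 := momFunctional_rootPoly_eq_zero (convexHull_subset_affineSpan _ (h hmem))
    rw [momFunctional_momCurve (Lagrange.natDegree_nodal).le] at h0
    exact (eval_rootPoly_eq_zero_iff F a).1 h0
  · intro h
    exact convexHull_mono (Set.image_mono (by exact_mod_cast h))

/-- The number of elements of `F` greater than `i`. -/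
def countAbove (F : Finset ℕ) (i : ℕ) : ℕ := (F.filter (fun f => i < f)).card

theorem eval_rootPoly_sign (F : Finset ℕ) {i : ℕ} (hi : i ∉ F) :
    0 < (-1 : ℝ) ^ countAbove F i * (rootPoly F).eval (i : ℝ) := by
  rw [Lagrange.eval_nodal, countAbove]
  induction F using Finset.induction_on with
  | empty => simp
  | insert x F hx ih =>
    rw [Finset.mem_insert, not_or] at hi
    have ih := ih hi.2
    rw [Finset.prod_insert hx, Finset.filter_insert]
    split_ifs with hlt
    · have hlt' : (i : ℝ) < x := by exact_mod_cast hlt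
      rw [Finset.card_insert_of_notMem (by simp [hx]), pow_succ]
      nlinarith
    · have hlt' : (x : ℝ) < i := by exact_mod_cast (by omega : x < i)
      nlinarith

theorem even_countAbove_of_pos {F : Finset ℕ} {i : ℕ} (hi : i ∉ F)
    (h : 0 < (rootPoly F).eval (i : ℝ)) : Even (countAbove F i) := by
  by_contra hodd
  have := eval_rootPoly_sign F hi
  rw [(Nat.not_even_iff_odd.1 hodd).neg_one_pow] at this
  linarith

theorem odd_countAbove_of_neg {F : Finset ℕ} {i : ℕ} (hi : i ∉ F)
    (h : (rootPoly F).eval (i : ℝ) < 0) : Odd (countAbove F i) := by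
  by_contra heven
  have := eval_rootPoly_sign F hi
  rw [(Nat.not_odd_iff_even.1 heven).neg_one_pow] at this
  linarith

theorem countAbove_lt_card {F : Finset ℕ} {a : ℕ} (ha : a ∈ F) : countAbove F a < F.card :=
  Finset.card_lt_card (Finset.filter_ssubset.2 ⟨a, ha, lt_irrefl a⟩)

theorem countAbove_lt_of_lt {F : Finset ℕ} {a b : ℕ} (hb : b ∈ F) (hab : a < b) :
    countAbove F b < countAbove F a := by
  refine Finset.card_lt_card (Finset.ssubset_iff_of_subset ?_ |>.2 ⟨b, ?_, ?_⟩)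
  · exact Finset.monotone_filter_right F fun x _ hx => lt_trans hab hx
  · simp [hb, hab]
  · simp

theorem countAbove_pred {F : Finset ℕ} {b : ℕ} (hb : b ∈ F) (hb1 : 1 ≤ b) :
    countAbove F (b - 1) = countAbove F b + 1 := by
  have : F.filter (fun f => b - 1 < f) = insert b (F.filter (fun f => b < f)) := by
    ext x
    simp only [Finset.mem_filter, Finset.mem_insert]
    constructor
    · rintro ⟨hx, hlt⟩
      by_cases hxb : x = b
      · exact Or.inl hxb
      · exact Or.inr ⟨hx, by omega⟩
    · rintro (rfl | ⟨hx, hlt⟩)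
      · exact ⟨hb, by omega⟩
      · exact ⟨hx, by omega⟩
  rw [countAbove, this, Finset.card_insert_of_notMem (by simp), countAbove]

/-- If the counts at two elements of `F` differ by one and the smaller one does not have the
parity attained at the elements outside `F`, then the two elements are adjacent. -/
theorem succ_eq_of_countAbove {m : ℕ} {F : Finset ℕ} (hF : F ⊆ Finset.Icc 1 m) {a b : ℕ}
    (ha : a ∈ F) (hb : b ∈ F) (hab : countAbove F a = countAbove F b + 1)
    (hpar : ∀ i ∈ Finset.Icc 1 m, i ∉ F → countAbove F i % 2 = countAbove F b % 2) :
    b = a + 1 := by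
  have ha1 := Finset.mem_Icc.1 (hF ha)
  have hb1 := Finset.mem_Icc.1 (hF hb)
  have hlt : a < b := by
    by_contra hle
    rcases Nat.lt_or_eq_of_le (not_lt.1 hle) with h | h
    · have := countAbove_lt_of_lt ha h
      omega
    · subst h
      omega
  by_contra hne
  have hpred := countAbove_pred hb hb1.1
  have hmem : b - 1 ∉ F := fun h => by
    have := countAbove_lt_of_lt h (by omega : a < b - 1)
    omega
  have := hpar (b - 1) (Finset.mem_Icc.2 (by omega)) hmem
  omega

theorem not_subset_lowerFacet {d m : ℕ} {A F : Finset ℕ} (hAc : A.card = d + 1)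
    (hadj : ∀ a ∈ A, a + 1 ∉ A) (hF : F ⊆ Finset.Icc 1 m) (hFc : F.card = 2 * d)
    (hpar : ∀ i ∈ Finset.Icc 1 m, i ∉ F → Even (countAbove F i)) : ¬ A ⊆ F := by
  intro hAF
  obtain ⟨a, ha, b, hb, hab, heq⟩ := Finset.exists_ne_map_eq_of_card_lt_of_maps_to
    (s := A) (t := Finset.range d) (f := fun a => countAbove F a / 2) (by simp [hAc])
    (fun a ha => by
      have := countAbove_lt_card (hAF ha)
      simp only [Finset.coe_range, Set.mem_Iio]
      omega)
  wlog hlt : a < b generalizing a b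
  · exact this b hb a ha hab.symm heq.symm (by omega)
  have hc := countAbove_lt_of_lt (hAF hb) hlt
  have := succ_eq_of_countAbove hF (hAF ha) (hAF hb) (by omega) fun i hi hiF => by
    have := Nat.even_iff.1 (hpar i hi hiF)
    omega
  exact hadj a ha (this ▸ hb)

theorem not_subset_upperFacet {d m : ℕ} (hd : 1 ≤ d) {A F : Finset ℕ} (hAc : A.card = d + 1)
    (hadj : ∀ a ∈ A, a + 1 ∉ A) (hwrap : ∀ a ∈ A, ∀ b ∈ A, a + 2 ≤ b + m)
    (hF : F ⊆ Finset.Icc 1 m) (hFc : F.card = 2 * d)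
    (hpar : ∀ i ∈ Finset.Icc 1 m, i ∉ F → Odd (countAbove F i)) : ¬ A ⊆ F := by
  intro hAF
  obtain ⟨a, ha, b, hb, hab, heq⟩ := Finset.exists_ne_map_eq_of_card_lt_of_maps_to
    (s := A) (t := Finset.range d) (f := fun a => (countAbove F a + 1) / 2 % d) (by simp [hAc])
    (fun a _ => by
      simp only [Finset.coe_range, Set.mem_Iio]
      exact Nat.mod_lt _ hd)
  wlog hlt : a < b generalizing a b
  · exact this b hb a ha hab.symm heq.symm (by omega)
  have hc := countAbove_lt_of_lt (hAF hb) hlt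
  have hca := countAbove_lt_card (hAF ha)
  have ha1 := Finset.mem_Icc.1 (hF (hAF ha))
  have hb1 := Finset.mem_Icc.1 (hF (hAF hb))
  rw [Nat.mod_eq_of_lt (by omega : (countAbove F b + 1) / 2 < d)] at heq
  rcases Nat.lt_or_ge ((countAbove F a + 1) / 2) d with h | h
  · rw [Nat.mod_eq_of_lt h] at heq
    have := succ_eq_of_countAbove hF (hAF ha) (hAF hb) (by omega) fun i hi hiF => by
      have := Nat.odd_iff.1 (hpar i hi hiF)
      omega
    exact hadj a ha (this ▸ hb)
  · have hd' : (countAbove F a + 1) / 2 = d := by omega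
    rw [hd', Nat.mod_self] at heq
    have hone : a = 1 := by
      by_contra hne
      by_cases h1 : 1 ∈ F
      · have := countAbove_lt_of_lt (hAF ha) (by omega : 1 < a)
        have := countAbove_lt_card h1
        omega
      · have hpred := Nat.odd_iff.1 (hpar 1 (Finset.mem_Icc.2 (by omega)) h1)
        have := countAbove_lt_of_lt (hAF ha) (by omega : 1 < a)
        have hle : countAbove F 1 ≤ F.card := Finset.card_filter_le _ _
        omega
    have hlast : b = m := by
      by_contra hne
      by_cases hm : m ∈ F
      · have := countAbove_lt_of_lt hm (by omega : b < m)
        omega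
      · have hodd := Nat.odd_iff.1 (hpar m (Finset.mem_Icc.2 (by omega)) hm)
        have hzero : countAbove F m = 0 := by
          rw [countAbove, Finset.card_eq_zero, Finset.filter_eq_empty_iff]
          intro x hx
          have := Finset.mem_Icc.1 (hF hx)
          omega
        omega
    have := hwrap b hb a ha
    omega

/-- Signed Gale condition: outside `F`, the polynomial `rootPoly F` has the sign of `s` on
`{1, …, m}`. -/
def SignedOn (m : ℕ) (s : ℝ) (F : Finset ℕ) : Prop :=
  F ⊆ Finset.Icc 1 m ∧ ∀ i ∈ Finset.Icc 1 m, i ∉ F → 0 < s * (rootPoly F).eval (i : ℝ)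

theorem SignedOn.exists_insert {m : ℕ} {s : ℝ} {F : Finset ℕ} (hF : SignedOn m s F)
    (hcard : F.card + 1 < m) {x : ℕ} (hx : x ∈ Finset.Icc 1 m) (hxF : x ∉ F) :
    ∃ F', SignedOn m s F' ∧ insert x F ⊆ F' ∧ F'.card = F.card + 2 := by
  have hne : (Finset.Icc 1 m \ insert x F).Nonempty := by
    rw [← Finset.card_pos]
    have h1 := Finset.le_card_sdiff (insert x F) (Finset.Icc 1 m)
    rw [Finset.card_insert_of_notMem hxF, Nat.card_Icc] at h1
    omega
  obtain ⟨y, hy, hmin⟩ := Finset.exists_min_image _ (fun y : ℕ => |(y : ℝ) - x|) hne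
  rw [Finset.mem_sdiff] at hy
  refine ⟨insert y (insert x F), ⟨?_, ?_⟩, Finset.subset_insert _ _, ?_⟩
  · exact Finset.insert_subset hy.1 (Finset.insert_subset hx hF.1)
  · intro i hi hiF
    have hyi : i ≠ y := fun h => hiF (by simp [h])
    have hixF : i ∉ insert x F := fun h => hiF (Finset.mem_insert_of_mem h)
    have hxi : i ≠ x := fun h => hixF (by simp [h])
    have hdist := hmin i (Finset.mem_sdiff.2 ⟨hi, hixF⟩)
    have hpos := hF.2 i hi fun h => hixF (Finset.mem_insert_of_mem h)
    have hyi' : (i : ℝ) - y ≠ 0 := sub_ne_zero.2 (by exact_mod_cast hyi)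
    have hxi' : (i : ℝ) - x ≠ 0 := sub_ne_zero.2 (by exact_mod_cast hxi)
    have hprod : 0 < ((i : ℝ) - y) * ((i : ℝ) - x) := by
      have hsq := sq_le_sq.2 hdist
      rcases lt_or_gt_of_ne hyi' with h1 | h1 <;> rcases lt_or_gt_of_ne hxi' with h2 | h2
      · exact mul_pos_of_neg_of_neg h1 h2
      · nlinarith
      · nlinarith
      · exact mul_pos h1 h2
    rw [Lagrange.eval_nodal] at hpos ⊢
    rw [Finset.prod_insert hy.2, Finset.prod_insert hxF]
    have := mul_pos hprod hpos
    linarith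
  · rw [Finset.card_insert_of_notMem hy.2, Finset.card_insert_of_notMem hxF]

theorem SignedOn.exists_extend {m : ℕ} {s : ℝ} {F : Finset ℕ} (hF : SignedOn m s F)
    (C : Finset ℕ) (hC : C ⊆ Finset.Icc 1 m) (hcard : F.card + 2 * C.card < m + 1) :
    ∃ F', SignedOn m s F' ∧ F ∪ C ⊆ F' ∧ F'.card = F.card + 2 * C.card := by
  induction C using Finset.induction_on with
  | empty => exact ⟨F, hF, by simp, by simp⟩
  | insert x C hx ih =>
    rw [Finset.card_insert_of_notMem hx] at hcard ⊢
    obtain ⟨G, hG, hsub, hGc⟩ :=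
      ih (fun y hy => hC (Finset.mem_insert_of_mem hy)) (by omega)
    obtain ⟨y, hy, hyG, hxy⟩ : ∃ y ∈ Finset.Icc 1 m, y ∉ G ∧ x ∈ insert y G := by
      by_cases hxG : x ∈ G
      · obtain ⟨y, hy, hyG⟩ := Finset.exists_mem_notMem_of_card_lt_card
          (s := G) (t := Finset.Icc 1 m) (by rw [Nat.card_Icc]; omega)
        exact ⟨y, hy, hyG, Finset.mem_insert_of_mem hxG⟩
      · exact ⟨x, hC (Finset.mem_insert_self _ _), hxG, Finset.mem_insert_self _ _⟩
    obtain ⟨F', hF', hsub', hF'c⟩ := hG.exists_insert (by omega) hy hyG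
    refine ⟨F', hF', ?_, by omega⟩
    rw [Finset.union_insert]
    exact Finset.insert_subset (hsub' hxy)
      (hsub.trans ((Finset.subset_insert _ _).trans hsub'))

theorem signedOn_pair_succ {m a : ℕ} (ha : a ∈ Finset.Icc 1 m) (ha' : a + 1 ∈ Finset.Icc 1 m) :
    SignedOn m 1 {a, a + 1} := by
  refine ⟨by simp [Finset.insert_subset_iff, ha, ha'], fun i _ hiF => ?_⟩
  simp only [Finset.mem_insert, Finset.mem_singleton, not_or] at hiF
  rw [Lagrange.eval_nodal, Finset.prod_pair (by omega), one_mul]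
  rcases lt_or_ge i a with h | h
  · have : (i : ℝ) < a := by exact_mod_cast h
    push_cast
    nlinarith
  · have : (a : ℝ) + 1 < i := by exact_mod_cast (by omega : a + 1 < i)
    push_cast
    nlinarith

theorem signedOn_pair_ends {m : ℕ} (hm : 2 ≤ m) : SignedOn m (-1) {1, m} := by
  refine ⟨?_, fun i hi hiF => ?_⟩
  · intro x hx
    simp only [Finset.mem_insert, Finset.mem_singleton] at hx
    exact Finset.mem_Icc.2 (by omega)
  simp only [Finset.mem_insert, Finset.mem_singleton, not_or] at hiF
  rw [Finset.mem_Icc] at hi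
  rw [Lagrange.eval_nodal, Finset.prod_pair (by omega)]
  have h1 : (1 : ℝ) < i := by exact_mod_cast (by omega : 1 < i)
  have h2 : (i : ℝ) < m := by exact_mod_cast (by omega : i < m)
  push_cast
  nlinarith

theorem SignedOn.exists_extend_of_subset {d m : ℕ} (hm : 2 * d + 1 ≤ m) {s : ℝ}
    {A B : Finset ℕ} (hA : A ⊆ Finset.Icc 1 m) (hAc : A.card = d + 1) (hB : SignedOn m s B)
    (hBA : B ⊆ A) (hBc : B.card = 2) :
    ∃ F, SignedOn m s F ∧ A ⊆ F ∧ F.card = 2 * d := by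
  have hle := Finset.card_le_card hBA
  have hsd := Finset.card_sdiff_of_subset hBA
  obtain ⟨F, hF, hsub, hFc⟩ :=
    hB.exists_extend (A \ B) (Finset.sdiff_subset.trans hA) (by omega)
  rw [Finset.union_sdiff_of_subset hBA] at hsub
  exact ⟨F, hF, hsub, by omega⟩

/-- `|A|_{2d}` is internal in `C(m, 2d)` iff consecutive entries of `A`
differ by at least 2 and moreover `max A + 2 ≤ min A + m`. -/
theorem statement5 (d m : ℕ) (hd : 1 ≤ d) (hm : 2 * d + 1 ≤ m)
    (A : Finset ℕ) (hA : A ⊆ Finset.Icc 1 m) (hAc : A.card = d + 1) :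
    (¬ ∃ F : Finset ℕ, (IsLowerFacet m (2 * d) F ∨ IsUpperFacet m (2 * d) F) ∧
        smp (2 * d) A ⊆ smp (2 * d) F) ↔
      ((∀ a ∈ A, a + 1 ∉ A) ∧ ∀ a ∈ A, ∀ b ∈ A, a + 2 ≤ b + m) := by
  have hδ : 1 ≤ 2 * d := by omega
  simp only [isLowerFacet_iff hδ, isUpperFacet_iff hδ]
  constructor
  · intro hint
    constructor
    · intro a ha ha'
      obtain ⟨F, hF, hAF, hFc⟩ := (signedOn_pair_succ (hA ha) (hA ha')).exists_extend_of_subset hm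
        hA hAc (by simp [Finset.insert_subset_iff, ha, ha']) (Finset.card_pair (by omega))
      refine hint ⟨F, Or.inl ⟨hF.1, hFc, fun i hi hiF => ?_⟩, hFc ▸ smp_subset_smp_iff.2 hAF⟩
      simpa only [one_mul] using hF.2 i hi hiF
    · intro a ha b hb
      by_contra hlt
      have ha1 := Finset.mem_Icc.1 (hA ha)
      have hb1 := Finset.mem_Icc.1 (hA hb)
      obtain rfl : a = m := by omega
      obtain rfl : b = 1 := by omega
      obtain ⟨F, hF, hAF, hFc⟩ := (signedOn_pair_ends (by omega)).exists_extend_of_subset hm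
        hA hAc (by simp [Finset.insert_subset_iff, ha, hb]) (Finset.card_pair (by omega))
      refine hint ⟨F, Or.inr ⟨hF.1, hFc, fun i hi hiF => ?_⟩, hFc ▸ smp_subset_smp_iff.2 hAF⟩
      have := hF.2 i hi hiF
      linarith
  · rintro ⟨hadj, hwrap⟩ ⟨F, hfacet, hsub⟩
    rcases hfacet with ⟨hF, hFc, hsign⟩ | ⟨hF, hFc, hsign⟩
    · exact not_subset_lowerFacet hAc hadj hF hFc
        (fun i hi hiF => even_countAbove_of_pos hiF (hsign i hi hiF))
        (smp_subset_smp_iff.1 (hFc.symm ▸ hsub))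
    · exact not_subset_upperFacet hd hAc hadj hwrap hF hFc
        (fun i hi hiF => odd_countAbove_of_neg hiF (hsign i hi hiF))
        (smp_subset_smp_iff.1 (hFc.symm ▸ hsub))
end
end
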